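/- arXiv:2202.13641 — 7 statements merged into one kernel-verified Lean document; each statement's English description precedes it below -/
import Mathlib

section
/- Let G be a finite group and A = A⁻¹, B = B⁻¹ symmetric subsets of G with |A| = |B| = Δ satisfying TNC. Let C_A ⊆ F₂^A and C_B ⊆ F₂^B be linear codes with dim C_A = ρΔ and dim C_B = (1−ρ)Δ for some ρ ∈ [0,1]. Then the number of squares is |Q| = Δ²|G|/2, and the quantum Tanner code satisfies dim 𝒞₀ + dim 𝒞₁ − |Q| ≥ (2ρ−1)²·|Q|. -/
noncomputable section

/-- Hamming weight of a binary word. -/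
def wt {ι : Type*} (x : ι → ZMod 2) : ℕ := {i | x i ≠ 0}.ncard

/-- Hamming distance from a word to a set of words. -/
def distTo {ι : Type*} (x : ι → ZMod 2) (S : Set (ι → ZMod 2)) : ℕ :=
  sInf {d : ℕ | ∃ c ∈ S, wt (x - c) = d}

/-- Minimum distance of a linear code. -/
def minDist {ι : Type*} (C : Submodule (ZMod 2) (ι → ZMod 2)) : ℕ :=
  sInf {d : ℕ | ∃ c ∈ C, c ≠ 0 ∧ wt c = d}

/-- Dual code with respect to the standard bilinear form. -/
def dualCode {ι : Type*} [Finite ι] (C : Submodule (ZMod 2) (ι → ZMod 2)) :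
    Submodule (ZMod 2) (ι → ZMod 2) :=
  letI := Fintype.ofFinite ι
  { carrier := {x | ∀ c ∈ C, ∑ i, x i * c i = 0}
    add_mem' := by
      intro x y hx hy c hc
      have h : ∑ i, (x + y) i * c i = (∑ i, x i * c i) + ∑ i, y i * c i := by
        simp [add_mul, Finset.sum_add_distrib]
      simp only [Set.mem_setOf_eq] at *
      rw [h, hx c hc, hy c hc, add_zero]
    zero_mem' := by
      simp
    smul_mem' := by
      intro t x hx c hc
      have h : ∑ i, (t • x) i * c i = t * ∑ i, x i * c i := by
        simp [Finset.mul_sum, mul_assoc]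
      simp only [Set.mem_setOf_eq] at *
      rw [h, hx c hc, mul_zero] }

/-- The code of matrices all of whose columns lie in `CA`. -/
def colCode {A : Type*} (B : Type*) (CA : Submodule (ZMod 2) (A → ZMod 2)) :
    Submodule (ZMod 2) (A × B → ZMod 2) where
  carrier := {x | ∀ b : B, (fun a => x (a, b)) ∈ CA}
  add_mem' := by intro x y hx hy b; exact CA.add_mem (hx b) (hy b)
  zero_mem' := by intro b; exact CA.zero_mem
  smul_mem' := by intro t x hx b; exact CA.smul_mem t (hx b)

/-- The code of matrices all of whose rows lie in `CB`. -/
def rowCode (A : Type*) {B : Type*} (CB : Submodule (ZMod 2) (B → ZMod 2)) :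
    Submodule (ZMod 2) (A × B → ZMod 2) where
  carrier := {x | ∀ a : A, (fun b => x (a, b)) ∈ CB}
  add_mem' := by intro x y hx hy a; exact CB.add_mem (hx a) (hy a)
  zero_mem' := by intro a; exact CB.zero_mem
  smul_mem' := by intro t x hx a; exact CB.smul_mem t (hx a)

/-- Tensor code `C_A ⊗ C_B`. -/
def tensorCode {A B : Type*} (CA : Submodule (ZMod 2) (A → ZMod 2))
    (CB : Submodule (ZMod 2) (B → ZMod 2)) : Submodule (ZMod 2) (A × B → ZMod 2) :=
  colCode B CA ⊓ rowCode A CB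

/-- Dual tensor code `C_A ⊗ F₂^B + F₂^A ⊗ C_B`. -/
def dualTensor {A B : Type*} (CA : Submodule (ZMod 2) (A → ZMod 2))
    (CB : Submodule (ZMod 2) (B → ZMod 2)) : Submodule (ZMod 2) (A × B → ZMod 2) :=
  colCode B CA ⊔ rowCode A CB

/-- `w`-robustness of the dual tensor code of `CA` and `CB`. -/
def IsRobust {A B : Type*} (CA : Submodule (ZMod 2) (A → ZMod 2))
    (CB : Submodule (ZMod 2) (B → ZMod 2)) (w : ℝ) : Prop :=
  ∀ c ∈ dualTensor CA CB, (wt c : ℝ) ≤ w →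
    ∃ (A' : Set A) (B' : Set B),
      (A'.ncard : ℝ) ≤ (wt c : ℝ) / (minDist CB : ℝ) ∧
      (B'.ncard : ℝ) ≤ (wt c : ℝ) / (minDist CA : ℝ) ∧
      ∀ a b, a ∉ A' → b ∉ B' → c (a, b) = 0

/-- Punctured code: restrictions of codewords of `C` to the coordinates in `A'`. -/
def punct {A : Type*} (C : Submodule (ZMod 2) (A → ZMod 2)) (A' : Set A) :
    Submodule (ZMod 2) (↥A' → ZMod 2) :=
  C.map (LinearMap.funLeft (ZMod 2) (ZMod 2) ((↑) : ↥A' → A))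

/-- `w`-robustness with `p`-resistance to puncturing. -/
def IsRobustPunct {A B : Type*} [Finite A] [Finite B]
    (CA : Submodule (ZMod 2) (A → ZMod 2)) (CB : Submodule (ZMod 2) (B → ZMod 2))
    (w p : ℝ) : Prop :=
  ∀ (A' : Set A) (B' : Set B) (w' : ℕ), (w' : ℝ) ≤ p →
    A'.ncard + w' = Nat.card A → B'.ncard + w' = Nat.card B →
    IsRobust (punct CA A') (punct CB B') w

section Complex

variable {G : Type*} [Group G] [DecidableEq G]

/-- Total no-conjugacy condition. -/
def TNC (A B : Set G) : Prop := ∀ g : G, ∀ a ∈ A, ∀ b ∈ B, a * g ≠ g * b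

/-- The square associated to `(g, a, b)`. -/
def cpxSq (g a b : G) : Finset (G × Bool) :=
  {(g, false), (a * g, true), (g * b, true), (a * g * b, false)}

/-- The set `Q` of squares of the left-right Cayley complex. -/
def Squares (A B : Set G) : Set (Finset (G × Bool)) :=
  {q | ∃ g : G, ∃ a ∈ A, ∃ b ∈ B, q = cpxSq g a b}

/-- Local view of `x : F₂^Q` at the vertex `(g, 0) ∈ V₀`, as an element of `F₂^{A×B}`. -/
def lview0 (A B : Set G) (x : ↥(Squares A B) → ZMod 2) (g : G) :
    ↥A × ↥B → ZMod 2 :=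
  fun ab => x ⟨cpxSq g (ab.1 : G) (ab.2 : G), ⟨g, (ab.1 : G), ab.1.2, (ab.2 : G), ab.2.2, rfl⟩⟩

/-- Local view of `x : F₂^Q` at the vertex `(g, 1) ∈ V₁`, as an element of `F₂^{A×B}`. -/
def lview1 {A B : Set G} (hA : ∀ a ∈ A, a⁻¹ ∈ A) (x : ↥(Squares A B) → ZMod 2) (g : G) :
    ↥A × ↥B → ZMod 2 :=
  fun ab => x ⟨cpxSq ((ab.1 : G) * g) (ab.1 : G)⁻¹ (ab.2 : G),
    ⟨(ab.1 : G) * g, (ab.1 : G)⁻¹, hA _ ab.1.2, (ab.2 : G), ab.2.2, rfl⟩⟩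

/-- The classical code 𝒞₀ of the quantum Tanner code: all local views at
vertices of `V₀` lie in `C₀^⊥ = (C_A ⊗ C_B)^⊥`. -/
def qC0 [Finite G] (A B : Set G) (CA : Submodule (ZMod 2) (↥A → ZMod 2))
    (CB : Submodule (ZMod 2) (↥B → ZMod 2)) :
    Submodule (ZMod 2) (↥(Squares A B) → ZMod 2) where
  carrier := {x | ∀ g : G, lview0 A B x g ∈ dualCode (tensorCode CA CB)}
  add_mem' := by
    intro x y hx hy g
    exact (dualCode (tensorCode CA CB)).add_mem (hx g) (hy g)
  zero_mem' := by
    intro g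
    exact (dualCode (tensorCode CA CB)).zero_mem
  smul_mem' := by
    intro t x hx g
    exact (dualCode (tensorCode CA CB)).smul_mem t (hx g)

/-- The classical code 𝒞₁ of the quantum Tanner code: all local views at
vertices of `V₁` lie in `C₁^⊥ = (C_A^⊥ ⊗ C_B^⊥)^⊥`. -/
def qC1 [Finite G] {A B : Set G} (hA : ∀ a ∈ A, a⁻¹ ∈ A)
    (CA : Submodule (ZMod 2) (↥A → ZMod 2)) (CB : Submodule (ZMod 2) (↥B → ZMod 2)) :
    Submodule (ZMod 2) (↥(Squares A B) → ZMod 2) where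
  carrier := {x | ∀ g : G, lview1 hA x g ∈ dualCode (tensorCode (dualCode CA) (dualCode CB))}
  add_mem' := by
    intro x y hx hy g
    exact (dualCode (tensorCode (dualCode CA) (dualCode CB))).add_mem (hx g) (hy g)
  zero_mem' := by
    intro g
    exact (dualCode (tensorCode (dualCode CA) (dualCode CB))).zero_mem
  smul_mem' := by
    intro t x hx g
    exact (dualCode (tensorCode (dualCode CA) (dualCode CB))).smul_mem t (hx g)

/-- Adjacency matrix of the left Cayley graph `Cay(G, A)`. -/
def cayAdjL (A : Set G) : Matrix G G ℝ :=
  fun g g' => A.indicator (fun _ => (1 : ℝ)) (g' * g⁻¹)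

/-- Adjacency matrix of the right Cayley graph `Cay(G, B)`. -/
def cayAdjR (B : Set G) : Matrix G G ℝ :=
  fun g g' => B.indicator (fun _ => (1 : ℝ)) (g⁻¹ * g')

end Complex

/-- A `Δ`-regular graph (given by its adjacency matrix) is Ramanujan if every
eigenvalue other than `±Δ` has absolute value at most `2√(Δ-1)`. -/
def IsRamanujan {V : Type*} [Fintype V] (M : Matrix V V ℝ) (Δ : ℝ) : Prop :=
  ∀ μ : ℝ, (∃ x : V → ℝ, x ≠ 0 ∧ M.mulVec x = μ • x) → μ ≠ Δ → μ ≠ -Δ →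
    |μ| ≤ 2 * Real.sqrt (Δ - 1)

/-- Probability of the event `S` under the uniform distribution on a finite type. -/
def unifProb {Ω : Type*} [Fintype Ω] (S : Set Ω) : ℝ :=
  (S.ncard : ℝ) / (Fintype.card Ω : ℝ)

end

theorem mem_dualCode {ι : Type*} [Fintype ι] {C : Submodule (ZMod 2) (ι → ZMod 2)}
    {x : ι → ZMod 2} : x ∈ dualCode C ↔ ∀ c ∈ C, x ⬝ᵥ c = 0 := by
  change (∀ c ∈ C, @Finset.sum _ _ _ (@Finset.univ _ (Fintype.ofFinite ι)) _ = 0) ↔ _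
  rw [Subsingleton.elim (Fintype.ofFinite ι) ‹Fintype ι›]
  rfl

theorem finrank_add_finrank_dualCode {ι : Type*} [Fintype ι]
    (C : Submodule (ZMod 2) (ι → ZMod 2)) :
    Module.finrank (ZMod 2) C + Module.finrank (ZMod 2) (dualCode C) = Fintype.card ι := by
  classical
  have h : dualCode C =
      C.dualAnnihilator.map (dotProductEquiv (ZMod 2) ι).symm.toLinearMap := by
    rw [Submodule.map_equiv_eq_comap_symm, LinearEquiv.symm_symm]
    ext x
    simp [mem_dualCode, Submodule.mem_dualAnnihilator]
  rw [h, LinearEquiv.finrank_map_eq, Subspace.finrank_add_finrank_dualAnnihilator_eq, Module.finrank_fintype_fun_eq_card]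

theorem finrank_tensorCode_le {A B : Type*} [Finite A] [Finite B]
    (CA : Submodule (ZMod 2) (A → ZMod 2)) (CB : Submodule (ZMod 2) (B → ZMod 2)) :
    Module.finrank (ZMod 2) (tensorCode CA CB) ≤
      Module.finrank (ZMod 2) CA * Module.finrank (ZMod 2) CB := by
  classical
  have := Fintype.ofFinite A
  have := Fintype.ofFinite B
  obtain ⟨p, hp⟩ :=
    (LinearEquiv.ofFinrankEq CA (Fin (Module.finrank (ZMod 2) CA) → ZMod 2)
      (by simp)).toLinearMap.exists_extend
  have hp_inj : ∀ v ∈ CA, p v = 0 → v = 0 := by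
    intro v hv h
    have he := LinearMap.congr_fun hp ⟨v, hv⟩
    simp only [LinearMap.comp_apply, Submodule.subtype_apply, h, LinearEquiv.coe_coe] at he
    exact congrArg Subtype.val ((LinearEquiv.map_eq_zero_iff _).1 he.symm)
  let T : tensorCode CA CB →ₗ[ZMod 2] (Fin (Module.finrank (ZMod 2) CA) → CB) :=
    { toFun := fun x i => ⟨∑ a, p (Pi.single a 1) i • fun b => x.1 (a, b),
        CB.sum_mem fun a _ => CB.smul_mem _ (x.2.2 a)⟩
      map_add' := by
        intro x y
        ext i b
        simp [mul_add, Finset.sum_add_distrib]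
      map_smul' := by
        intro t x
        ext i b
        simp [Finset.mul_sum, mul_left_comm] }
  have hT : Function.Injective T := by
    rw [injective_iff_map_eq_zero]
    intro x hx
    ext ⟨a, b⟩
    refine congrFun (hp_inj (fun a => x.1 (a, b)) (x.2.1 b) ?_) a
    ext i
    have h := congrFun (congrArg Subtype.val (congrFun hx i)) b
    rw [LinearMap.pi_apply_eq_sum_univ p]
    have hs : ∀ a : A, (fun j => if a = j then (1 : ZMod 2) else 0) = Pi.single a 1 := by
      intro a
      ext j
      simp [Pi.single_apply, eq_comm]
    simpa [T, mul_comm, hs] using h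
  simpa [Module.finrank_pi_fintype] using LinearMap.finrank_le_finrank_of_injective hT

/-- A Tanner code with local codes `dualCode C` satisfies at most `finrank C` independent parity
checks per vertex. -/
theorem finrank_le_finrank_add_of_forall_mem_dualCode {V W κ : Type*} [AddCommGroup V]
    [Module (ZMod 2) V] [FiniteDimensional (ZMod 2) V] [Fintype κ] [Finite W]
    (C : Submodule (ZMod 2) (W → ZMod 2)) (view : κ → V →ₗ[ZMod 2] (W → ZMod 2))
    (D : Submodule (ZMod 2) V) (hD : ∀ x, (∀ k, view k x ∈ dualCode C) → x ∈ D) :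
    Module.finrank (ZMod 2) V ≤
      Module.finrank (ZMod 2) D + Fintype.card κ * Module.finrank (ZMod 2) C := by
  classical
  have := Fintype.ofFinite W
  let T : V →ₗ[ZMod 2] (κ → Module.Dual (ZMod 2) C) :=
    LinearMap.pi fun k => C.subtype.dualMap ∘ₗ (dotProductEquiv (ZMod 2) W).toLinearMap ∘ₗ view k
  have hker : LinearMap.ker T ≤ D := by
    intro x hx
    refine hD x fun k => mem_dualCode.2 fun c hc => ?_
    exact LinearMap.congr_fun (congrFun hx k) ⟨c, hc⟩
  have hrange := (LinearMap.range T).finrank_le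
  have hle := Submodule.finrank_mono hker
  have hsum := T.finrank_range_add_finrank_ker
  rw [Module.finrank_pi_fintype] at hrange
  simp only [Subspace.dual_finrank_eq, Finset.sum_const, Finset.card_univ, smul_eq_mul] at hrange
  omega

section Complex

variable {G : Type*} [Group G] [DecidableEq G] {A B : Set G}

theorem cpxSq_opposite (g a b : G) : cpxSq (a * g * b) a⁻¹ b⁻¹ = cpxSq g a b := by
  ext x
  simp only [cpxSq, Finset.mem_insert, Finset.mem_singleton, mul_assoc, inv_mul_cancel_left,
    mul_inv_cancel, mul_one]
  tauto

theorem TNC.cpxSq_injective (htnc : TNC A B) {g a b a' b' : G} (ha : a ∈ A) (hb : b ∈ B)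
    (ha' : a' ∈ A) (hb' : b' ∈ B) (h : cpxSq g a b = cpxSq g a' b') : a = a' ∧ b = b' := by
  have h₁ : (a * g, true) ∈ cpxSq g a' b' := h ▸ by simp [cpxSq]
  have h₂ : (g * b, true) ∈ cpxSq g a' b' := h ▸ by simp [cpxSq]
  have n₁ := htnc g a ha b' hb'
  have n₂ := (htnc g a' ha' b hb).symm
  simp_all [cpxSq]

theorem TNC.cpxSq_eq_iff (hA : ∀ a ∈ A, a⁻¹ ∈ A) (hB : ∀ b ∈ B, b⁻¹ ∈ B) (htnc : TNC A B)
    {g a b g' a' b' : G} (ha : a ∈ A) (hb : b ∈ B) (ha' : a' ∈ A) (hb' : b' ∈ B) :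
    cpxSq g' a' b' = cpxSq g a b ↔
      (g' = g ∧ a' = a ∧ b' = b) ∨ (g' = a * g * b ∧ a' = a⁻¹ ∧ b' = b⁻¹) := by
  constructor
  · intro h
    have hg : (g', false) ∈ cpxSq g a b := h ▸ by simp [cpxSq]
    have hg : g' = g ∨ g' = a * g * b := by simpa [cpxSq] using hg
    rcases hg with rfl | rfl
    · exact Or.inl ⟨rfl, htnc.cpxSq_injective ha' hb' ha hb h⟩
    · rw [← cpxSq_opposite g a b] at h
      exact Or.inr ⟨rfl, htnc.cpxSq_injective ha' hb' (hA a ha) (hB b hb) h⟩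
  · rintro (⟨rfl, rfl, rfl⟩ | ⟨rfl, rfl, rfl⟩)
    · rfl
    · exact cpxSq_opposite g a b

theorem two_mul_card_squares [Fintype G] (hA : ∀ a ∈ A, a⁻¹ ∈ A) (hB : ∀ b ∈ B, b⁻¹ ∈ B)
    (htnc : TNC A B) :
    2 * Nat.card (Squares A B) = Nat.card G * (A.ncard * B.ncard) := by
  classical
  let f : G × A × B → Squares A B := fun p =>
    ⟨cpxSq p.1 p.2.1 p.2.2, p.1, p.2.1, p.2.1.2, p.2.2, p.2.2.2, rfl⟩
  have hfib : ∀ q ∈ Finset.univ, (Finset.univ.filter fun p => f p = q).card = 2 := by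
    rintro ⟨_, g, a, ha, b, hb, rfl⟩ -
    have hne : (g, (⟨a, ha⟩ : A), (⟨b, hb⟩ : B)) ≠
        (a * g * b, ⟨a⁻¹, hA a ha⟩, ⟨b⁻¹, hB b hb⟩) := by
      intro h
      refine htnc g a ha b⁻¹ (hB b hb) (eq_mul_inv_of_mul_eq ?_)
      exact (congrArg Prod.fst h).symm
    rw [← Finset.card_pair hne]
    congr 1
    ext ⟨g', ⟨a', ha'⟩, ⟨b', hb'⟩⟩
    simpa [f, Subtype.ext_iff] using htnc.cpxSq_eq_iff hA hB ha hb ha' hb'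
  have h := Finset.card_eq_sum_card_fiberwise (f := f) (s := Finset.univ) (t := Finset.univ)
    (by simp)
  rw [Finset.sum_congr rfl hfib] at h
  simp only [Finset.sum_const, Finset.card_univ, smul_eq_mul, ← Nat.card_eq_fintype_card,
    Nat.card_prod, Nat.card_coe_set_eq] at h
  rw [Nat.card_coe_set_eq]
  linarith

end Complex

/-- number of squares of the complex and rate lower bound of the
quantum Tanner code. -/
theorem quantum_tanner_length_and_rate
    {G : Type*} [Group G] [Fintype G] [DecidableEq G]
    (A B : Set G) (hA : ∀ a ∈ A, a⁻¹ ∈ A) (hB : ∀ b ∈ B, b⁻¹ ∈ B)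
    (Δ : ℕ) (hcA : A.ncard = Δ) (hcB : B.ncard = Δ) (htnc : TNC A B)
    (CA : Submodule (ZMod 2) (↥A → ZMod 2)) (CB : Submodule (ZMod 2) (↥B → ZMod 2))
    (ρ : ℝ) (hρ0 : 0 ≤ ρ) (hρ1 : ρ ≤ 1)
    (hdimA : (Module.finrank (ZMod 2) CA : ℝ) = ρ * Δ)
    (hdimB : (Module.finrank (ZMod 2) CB : ℝ) = (1 - ρ) * Δ) :
    2 * Nat.card ↥(Squares A B) = Δ ^ 2 * Nat.card G ∧
    (Module.finrank (ZMod 2) (qC0 A B CA CB) : ℝ)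
        + (Module.finrank (ZMod 2) (qC1 hA CA CB) : ℝ)
        - (Nat.card ↥(Squares A B) : ℝ)
      ≥ (2 * ρ - 1)^2 * (Nat.card ↥(Squares A B) : ℝ) := by
  classical
  have hcard := two_mul_card_squares hA hB htnc
  rw [hcA, hcB] at hcard
  refine ⟨by rw [hcard]; ring, ?_⟩
  have h₀ := finrank_le_finrank_add_of_forall_mem_dualCode (tensorCode CA CB)
    (fun g : G => { toFun := fun x => lview0 A B x g
                    map_add' := fun _ _ => rfl
                    map_smul' := fun _ _ => rfl }) (qC0 A B CA CB) fun _ h => h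
  have h₁ := finrank_le_finrank_add_of_forall_mem_dualCode
    (tensorCode (dualCode CA) (dualCode CB))
    (fun g : G => { toFun := fun x => lview1 hA x g
                    map_add' := fun _ _ => rfl
                    map_smul' := fun _ _ => rfl }) (qC1 hA CA CB) fun _ h => h
  have ht₀ := finrank_tensorCode_le CA CB
  have ht₁ := finrank_tensorCode_le (dualCode CA) (dualCode CB)
  have hdA := finrank_add_finrank_dualCode CA
  have hdB := finrank_add_finrank_dualCode CB
  rw [← Nat.card_eq_fintype_card, Nat.card_coe_set_eq] at hdA hdB
  rw [hcA] at hdA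
  rw [hcB] at hdB
  rw [Module.finrank_fintype_fun_eq_card, ← Nat.card_eq_fintype_card,
    ← Nat.card_eq_fintype_card] at h₀ h₁
  replace h₀ := h₀.trans (Nat.add_le_add_left (Nat.mul_le_mul_left _ ht₀) _)
  replace h₁ := h₁.trans (Nat.add_le_add_left (Nat.mul_le_mul_left _ ht₁) _)
  rify at h₀ h₁ hdA hdB hcard
  have hdA' : (Module.finrank (ZMod 2) (dualCode CA) : ℝ) = (1 - ρ) * Δ := by linarith
  have hdB' : (Module.finrank (ZMod 2) (dualCode CB) : ℝ) = ρ * Δ := by linarith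
  rw [hdimA, hdimB] at h₀
  rw [hdA', hdB'] at h₁
  linear_combination h₀ + h₁ - 2 * ρ * (1 - ρ) * hcard
end

section
/- Let G be a finite group and A = A⁻¹, B = B⁻¹ symmetric subsets of G with |A| = |B| = Δ satisfying TNC, and let C_A ⊆ F₂^A, C_B ⊆ F₂^B be arbitrary linear codes. Then the quantum Tanner code is a CSS pair: 𝒞₀^⊥ ⊆ 𝒞₁ (equivalently, 𝒞₁^⊥ ⊆ 𝒞₀), where orthogonality is with respect to the standard bilinear form on F₂^Q. -/
theorem mem_dualCode_iff {ι : Type*} [Fintype ι] {C : Submodule (ZMod 2) (ι → ZMod 2)}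
    {x : ι → ZMod 2} : x ∈ dualCode C ↔ ∀ c ∈ C, ∑ i, x i * c i = 0 := by
  have h : Fintype.ofFinite ι = ‹Fintype ι› := Subsingleton.elim _ _
  change (∀ c ∈ C, @Finset.sum _ _ _ (@Finset.univ _ (Fintype.ofFinite ι)) _ = 0) ↔ _
  rw [h]

/-- Under the total no-conjugacy condition, a square through `(g, 1)` with parameters `(a, b)`
coincides with a square through `(h, 0)` only along an edge of the complex. -/
theorem TNC.cpxSq_eq_cpxSq_iff {G : Type*} [Group G] [DecidableEq G] {A B : Set G}
    (htnc : TNC A B) (hA : ∀ a ∈ A, a⁻¹ ∈ A) {g h a b a' b' : G}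
    (ha : a ∈ A) (hb : b ∈ B) (ha' : a' ∈ A) (hb' : b' ∈ B) :
    cpxSq h a' b' = cpxSq (a * g) a⁻¹ b ↔
      (h = a * g ∧ a' = a⁻¹ ∧ b' = b) ∨ (h = g * b ∧ a' = a ∧ b' = b⁻¹) := by
  have hmid : ∀ k : G, ∀ c ∈ A, ∀ d ∈ B, k ≠ c * k * d := by
    intro k c hc d hd hk
    apply htnc k c⁻¹ (hA c hc) d hd
    nth_rewrite 1 [hk]
    group
  constructor
  · intro he
    have m1 : (h, false) ∈ cpxSq (a * g) a⁻¹ b := by rw [← he]; simp [cpxSq]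
    have m2 : (a' * h * b', false) ∈ cpxSq (a * g) a⁻¹ b := by rw [← he]; simp [cpxSq]
    have m3 : (g, true) ∈ cpxSq h a' b' := by rw [he]; simp [cpxSq]
    simp only [cpxSq, Finset.mem_insert, Finset.mem_singleton, Prod.mk.injEq, and_true,
      Bool.false_eq_true, and_false, false_or, or_false, reduceCtorEq,
      inv_mul_cancel_left] at m1 m2 m3
    rcases m1 with rfl | rfl
    · left
      rcases m3 with e | e
      · obtain rfl : a' = a⁻¹ := by
          apply eq_inv_of_mul_eq_one_left
          apply mul_right_cancel (b := g)
          rw [mul_assoc, ← e, one_mul]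
        rcases m2 with e2 | e2
        · exact absurd e2.symm (hmid _ _ ha' _ hb')
        · exact ⟨rfl, rfl, by simpa using e2⟩
      · exact absurd e (hmid _ _ ha _ hb')
    · right
      rcases m3 with e | e
      · exact absurd (e.trans (mul_assoc _ _ _).symm) (hmid _ _ ha' _ hb)
      · obtain rfl : b' = b⁻¹ := by
          apply eq_inv_of_mul_eq_one_right
          apply mul_left_cancel (a := g)
          rw [← mul_assoc, ← e, mul_one]
        rcases m2 with e2 | e2
        · exact ⟨rfl, by simpa [mul_assoc] using e2, rfl⟩
        · exact absurd e2.symm (hmid _ _ ha' _ hb')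
  · rintro (⟨rfl, rfl, rfl⟩ | ⟨rfl, rfl, rfl⟩)
    · rfl
    · ext ⟨k, _ | _⟩ <;> simp [cpxSq, mul_assoc, or_comm]

/-- the quantum Tanner code is a CSS pair: `𝒞₀^⊥ ⊆ 𝒞₁`
(equivalently `𝒞₁^⊥ ⊆ 𝒞₀`). -/
theorem quantum_tanner_css
    {G : Type*} [Group G] [Fintype G] [DecidableEq G]
    (A B : Set G) (hA : ∀ a ∈ A, a⁻¹ ∈ A) (hB : ∀ b ∈ B, b⁻¹ ∈ B)
    (Δ : ℕ) (hcA : A.ncard = Δ) (hcB : B.ncard = Δ) (htnc : TNC A B)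
    (CA : Submodule (ZMod 2) (↥A → ZMod 2)) (CB : Submodule (ZMod 2) (↥B → ZMod 2)) :
    dualCode (qC0 A B CA CB) ≤ qC1 hA CA CB := by
  classical
  have := Fintype.ofFinite A
  have := Fintype.ofFinite B
  have := Fintype.ofFinite (Squares A B)
  intro x hx g
  rw [mem_dualCode_iff] at hx ⊢
  intro c hc
  have hcol : ∀ b, ∀ u ∈ CA, ∑ a, c (a, b) * u a = 0 := fun b => mem_dualCode_iff.1 (hc.1 b)
  have hrow : ∀ a, ∀ u ∈ CB, ∑ b, c (a, b) * u b = 0 := fun a => mem_dualCode_iff.1 (hc.2 a)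
  let y : Squares A B → ZMod 2 := fun q =>
    ∑ ab : A × B, if (q : Finset (G × Bool)) = cpxSq (ab.1 * g) (ab.1 : G)⁻¹ ab.2
      then c ab else 0
  have hy : y ∈ qC0 A B CA CB := by
    intro h
    rw [mem_dualCode_iff]
    intro t ht
    have hsplit : ∀ (p : A × B) (q : A × B),
        (if cpxSq h (q.1 : G) q.2 = cpxSq (p.1 * g) (p.1 : G)⁻¹ p.2 then c p else 0) * t q =
        (if q = (⟨(p.1 : G)⁻¹, hA _ p.1.2⟩, p.2) then
          (if h = p.1 * g then c p * t q else 0) else 0) +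
        (if q = (p.1, ⟨(p.2 : G)⁻¹, hB _ p.2.2⟩) then
          (if h = g * p.2 then c p * t q else 0) else 0) := by
      rintro ⟨⟨a, ha⟩, ⟨b, hb⟩⟩ ⟨⟨a', ha'⟩, ⟨b', hb'⟩⟩
      have hne := htnc g a ha b hb
      simp only [htnc.cpxSq_eq_cpxSq_iff hA ha hb ha' hb', Prod.mk.injEq, Subtype.mk.injEq]
      by_cases h1 : h = a * g
      · simp [h1, hne]
      · simp [h1, ← ite_and, and_comm]
    calc ∑ q, lview0 A B y h q * t q
        = ∑ q : A × B, ∑ p : A × B,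
          (if cpxSq h (q.1 : G) q.2 = cpxSq (p.1 * g) (p.1 : G)⁻¹ p.2 then c p else 0) * t q := by
          simp only [lview0, y, Finset.sum_mul]
      _ = (∑ a : A, if h = a * g then
            ∑ b : B, c (a, b) * t (⟨(a : G)⁻¹, hA _ a.2⟩, b) else 0) +
          ∑ b : B, if h = g * b then
            ∑ a : A, c (a, b) * t (a, ⟨(b : G)⁻¹, hB _ b.2⟩) else 0 := by
          rw [Finset.sum_comm]
          simp only [hsplit, Finset.sum_add_distrib, Finset.sum_ite_eq',
            Finset.mem_univ, if_true]
          congr 1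
          · rw [Fintype.sum_prod_type]
            refine Finset.sum_congr rfl fun a _ => ?_
            split_ifs <;> simp
          · rw [Fintype.sum_prod_type_right]
            refine Finset.sum_congr rfl fun b _ => ?_
            split_ifs <;> simp
      _ = 0 := by
          rw [Finset.sum_eq_zero, Finset.sum_eq_zero, add_zero]
          · intro b _
            rw [hcol b _ (ht.1 ⟨(b : G)⁻¹, hB _ b.2⟩), ite_self]
          · intro a _
            rw [hrow a _ (ht.2 ⟨(a : G)⁻¹, hA _ a.2⟩), ite_self]
  rw [← hx y hy]
  simp only [y, Finset.mul_sum]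
  rw [Finset.sum_comm]
  refine Finset.sum_congr rfl fun p _ => ?_
  symm
  rw [Finset.sum_eq_single_of_mem
    (⟨cpxSq (p.1 * g) (p.1 : G)⁻¹ p.2, _, _, hA _ p.1.2, _, p.2.2, rfl⟩ : Squares A B)
    (Finset.mem_univ _)]
  · simp [lview1]
  · intro q _ hq
    rw [if_neg fun e => hq (Subtype.ext e), mul_zero]
end

section
/- (Expander mixing lemma.) Let M be a symmetric n×n matrix with nonnegative real entries all of whose row sums equal Δ, and let λ ≥ 0 be such that ‖Mx‖ ≤ λ‖x‖ for every x ∈ ℝⁿ orthogonal to the all-ones vector. Then for all subsets S, T of the index set, ∑_{s∈S, t∈T} M_{s,t} ≤ (Δ/n)·|S|·|T| + λ·√(|S|·|T|). -/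
/-- Euclidean norm on `Fin n → ℝ`. -/
noncomputable def euclNorm {n : ℕ} (x : Fin n → ℝ) : ℝ :=
  Real.sqrt (∑ i, (x i) ^ 2)

theorem sum_le_sqrt_card_mul_euclNorm {n : ℕ} (x : Fin n → ℝ) (S : Finset (Fin n)) :
    ∑ s ∈ S, x s ≤ √(S.card : ℝ) * euclNorm x := by
  rw [euclNorm, ← Real.sqrt_mul (Nat.cast_nonneg _)]
  apply Real.le_sqrt_of_sq_le
  calc (∑ s ∈ S, x s) ^ 2 ≤ S.card * ∑ s ∈ S, x s ^ 2 := sq_sum_le_card_mul_sum_sq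
    _ ≤ S.card * ∑ i, x i ^ 2 := by
      gcongr
      exact S.subset_univ

/-- The indicator vector of `T`, projected onto the orthogonal complement of the all-ones vector. -/
noncomputable def centeredIndicator {n : ℕ} (T : Finset (Fin n)) (i : Fin n) : ℝ :=
  (if i ∈ T then 1 else 0) - T.card / n

theorem sum_centeredIndicator {n : ℕ} (hn : 0 < n) (T : Finset (Fin n)) :
    ∑ i, centeredIndicator T i = 0 := by
  have hn' : (n : ℝ) ≠ 0 := by positivity
  simp [centeredIndicator, mul_div_cancel₀ _ hn']

theorem euclNorm_centeredIndicator_le {n : ℕ} (hn : 0 < n) (T : Finset (Fin n)) :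
    euclNorm (centeredIndicator T) ≤ √(T.card : ℝ) := by
  have hsq (i : Fin n) : centeredIndicator T i ^ 2 =
      (if i ∈ T then 1 else 0) - T.card / n * (T.card / n)
        - 2 * (T.card / n) * centeredIndicator T i := by
    unfold centeredIndicator
    split_ifs <;> ring
  apply Real.sqrt_le_sqrt
  simp_rw [hsq]
  rw [Finset.sum_sub_distrib, ← Finset.mul_sum, sum_centeredIndicator hn, Finset.sum_sub_distrib]
  simp only [Finset.sum_ite_mem, Finset.univ_inter, Finset.sum_const, Finset.card_univ,
    Fintype.card_fin, nsmul_eq_mul, mul_one, mul_zero, sub_zero]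
  exact sub_le_self _ (by positivity)

theorem mulVec_centeredIndicator {n : ℕ} (M : Matrix (Fin n) (Fin n) ℝ)
    {Δ : ℝ} (hreg : ∀ i, ∑ j, M i j = Δ) (T : Finset (Fin n)) (i : Fin n) :
    M.mulVec (centeredIndicator T) i = ∑ t ∈ T, M i t - Δ * (T.card / n) := by
  simp [Matrix.mulVec, dotProduct, centeredIndicator, mul_sub, Finset.sum_sub_distrib,
    ← Finset.sum_mul, hreg]

/-- Expander mixing lemma. -/
theorem expander_mixing_lemma
    (n : ℕ) (hn : 0 < n) (M : Matrix (Fin n) (Fin n) ℝ)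
    (hsym : M.IsSymm) (hnn : ∀ i j, 0 ≤ M i j)
    (Δ : ℝ) (hreg : ∀ i, ∑ j, M i j = Δ)
    (lam : ℝ) (hlam : 0 ≤ lam)
    (hspec : ∀ x : Fin n → ℝ, ∑ i, x i = 0 → euclNorm (M.mulVec x) ≤ lam * euclNorm x)
    (S T : Finset (Fin n)) :
    ∑ s ∈ S, ∑ t ∈ T, M s t ≤
      Δ / n * ((S.card : ℝ) * (T.card : ℝ))
        + lam * Real.sqrt ((S.card : ℝ) * (T.card : ℝ)) := by
  have hsum : ∑ s ∈ S, M.mulVec (centeredIndicator T) s =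
      ∑ s ∈ S, ∑ t ∈ T, M s t - Δ / n * ((S.card : ℝ) * (T.card : ℝ)) := by
    simp only [mulVec_centeredIndicator M hreg, Finset.sum_sub_distrib, Finset.sum_const,
      nsmul_eq_mul]
    ring
  rw [← sub_le_iff_le_add', ← hsum]
  calc ∑ s ∈ S, M.mulVec (centeredIndicator T) s
      ≤ √(S.card : ℝ) * euclNorm (M.mulVec (centeredIndicator T)) :=
        sum_le_sqrt_card_mul_euclNorm _ S
    _ ≤ √(S.card : ℝ) * (lam * √(T.card : ℝ)) := by
      gcongr
      exact (hspec _ (sum_centeredIndicator hn T)).trans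
        (mul_le_mul_of_nonneg_left (euclNorm_centeredIndicator_le hn T) hlam)
    _ = lam * √((S.card : ℝ) * (T.card : ℝ)) := by
      rw [Real.sqrt_mul (Nat.cast_nonneg _)]
      ring
end

section
/- Let C_A ⊆ F₂^A and C_B ⊆ F₂^B be linear codes of length Δ = |A| = |B| with minimum distances d_A and d_B, and suppose the dual tensor code C_A ⊗ F₂^B + F₂^A ⊗ C_B is w-robust for some w ≤ d_A·d_B/2. Then every x ∈ F₂^{A×B} with d(x, C_A ⊗ F₂^B) + d(x, F₂^A ⊗ C_B) ≤ w satisfies d(x, C_A ⊗ C_B) ≤ (3/2)·( d(x, C_A ⊗ F₂^B) + d(x, F₂^A ⊗ C_B) ). -/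
theorem wt_le_wt_add_wt {ι : Type*} [Finite ι] {u v z : ι → ZMod 2}
    (h : ∀ i, u i ≠ 0 → v i ≠ 0 ∨ z i ≠ 0) : wt u ≤ wt v + wt z :=
  (Set.ncard_le_ncard (t := {i | v i ≠ 0} ∪ {i | z i ≠ 0}) h (Set.toFinite _)).trans
    (Set.ncard_union_le _ _)

theorem eq_zero_of_wt_eq_zero {ι : Type*} [Finite ι] {u : ι → ZMod 2} (h : wt u = 0) : u = 0 := by
  have h' := (Set.ncard_eq_zero (Set.toFinite _)).mp h
  funext i
  by_contra hi
  exact Set.eq_empty_iff_forall_notMem.mp h' i hi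

theorem wt_comp_equiv {ι κ : Type*} (u : ι → ZMod 2) (e : κ ≃ ι) : wt (u ∘ e) = wt u :=
  Set.ncard_preimage_of_injective_subset_range (s := {i | u i ≠ 0}) e.injective
    (by simp [e.surjective.range_eq])

theorem minDist_le_wt {ι : Type*} {C : Submodule (ZMod 2) (ι → ZMod 2)} {u : ι → ZMod 2}
    (hu : u ∈ C) (h0 : u ≠ 0) : minDist C ≤ wt u :=
  Nat.sInf_le ⟨u, hu, h0, rfl⟩

/-- A codeword supported on fewer coordinates than the minimum distance vanishes. -/
theorem eq_zero_of_support_subset {ι : Type*} [Finite ι] {C : Submodule (ZMod 2) (ι → ZMod 2)}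
    {S : Set ι} (hS : S.ncard < minDist C) {u : ι → ZMod 2} (hu : u ∈ C)
    (hsupp : ∀ i ∉ S, u i = 0) : u = 0 := by
  by_contra h0
  have h1 := minDist_le_wt hu h0
  have h2 : wt u ≤ S.ncard := Set.ncard_le_ncard
    (fun i hi => by by_contra hiS; exact hi (hsupp i hiS)) (Set.toFinite _)
  omega

theorem distTo_le_wt_sub {ι : Type*} {x c : ι → ZMod 2} {S : Set (ι → ZMod 2)} (hc : c ∈ S) :
    distTo x S ≤ wt (x - c) :=
  Nat.sInf_le ⟨c, hc, rfl⟩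

theorem exists_wt_sub_eq_distTo {ι : Type*} (x : ι → ZMod 2)
    (C : Submodule (ZMod 2) (ι → ZMod 2)) :
    ∃ c ∈ C, wt (x - c) = distTo x (C : Set (ι → ZMod 2)) :=
  Nat.sInf_mem (s := {d : ℕ | ∃ c ∈ (C : Set (ι → ZMod 2)), wt (x - c) = d})
    ⟨_, 0, C.zero_mem, rfl⟩

/-- Erasures on fewer coordinates than the minimum distance can be corrected linearly. -/
theorem exists_erasure_decoder {ι : Type*} [Finite ι] {C : Submodule (ZMod 2) (ι → ZMod 2)}
    {S : Set ι} (hS : S.ncard < minDist C) :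
    ∃ E : (ι → ZMod 2) →ₗ[ZMod 2] (ι → ZMod 2),
      (∀ f, E f ∈ C) ∧ ∀ f, ∀ c ∈ C, (∀ i ∉ S, f i = c i) → E f = c := by
  let K : Submodule (ZMod 2) (ι → ZMod 2) := Submodule.pi Sᶜ (fun _ => ⊥)
  have hK : Disjoint C K := by
    rw [Submodule.disjoint_def]
    intro u hu huK
    exact eq_zero_of_support_subset hS hu fun i hi => by
      simpa using (Submodule.mem_pi.mp huK) i hi
  obtain ⟨K', hK', hcompl⟩ := hK.symm.exists_isCompl
  replace hcompl := hcompl.symm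
  refine ⟨C.projection K' hcompl, Submodule.projection_apply_mem hcompl, fun f c hc hfc => ?_⟩
  have h1 : C.projection K' hcompl (f - c) = 0 := by
    rw [Submodule.projection_apply_eq_zero_iff]
    refine hK' (Submodule.mem_pi.mpr fun i hi => ?_)
    simp [hfc i hi]
  rw [map_sub, sub_eq_zero] at h1
  rw [h1]
  exact Submodule.projection_apply_of_mem_left hcompl hc

/-- Applying a linear map to every row preserves the column code. -/
theorem map_rows_mem_colCode {A B : Type*} [Finite B] {CA : Submodule (ZMod 2) (A → ZMod 2)}
    (E : (B → ZMod 2) →ₗ[ZMod 2] (B → ZMod 2)) {c : A × B → ZMod 2} (hc : c ∈ colCode B CA) :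
    (fun p : A × B => E (fun b => c (p.1, b)) p.2) ∈ colCode B CA := by
  classical
  have := Fintype.ofFinite B
  intro b
  have h : (fun a => E (fun b => c (a, b)) b)
      = ∑ b', E (fun j => if b' = j then 1 else 0) b • fun a => c (a, b') := by
    funext a
    rw [LinearMap.pi_apply_eq_sum_univ]
    simp only [Finset.sum_apply, Pi.smul_apply, smul_eq_mul]
    exact Finset.sum_congr rfl fun b' _ => mul_comm _ _
  change (fun a => E (fun b => c (a, b)) b) ∈ CA
  rw [h]
  exact CA.sum_mem fun b' _ => CA.smul_mem _ (hc b')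

/-- A column codeword meets few rows in at most half of its weight. -/
theorem two_mul_ncard_inter_le_wt {A B : Type*} [Finite A] [Finite B]
    {CA : Submodule (ZMod 2) (A → ZMod 2)} {S : Set A} (hS : 2 * S.ncard ≤ minDist CA)
    {y z : A × B → ZMod 2} (hy : y ∈ colCode B CA) (hz : ∀ a b, a ∉ S → z (a, b) = 0) :
    2 * ({p | y p ≠ 0} ∩ {p | z p ≠ 0}).ncard ≤ wt y := by
  classical
  have := Fintype.ofFinite A
  have := Fintype.ofFinite B
  have key : ∀ T : Set (A × B), T.ncard = ∑ b, {a | (a, b) ∈ T}.ncard := fun T => by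
    rw [Set.ncard_eq_toFinset_card',
      Finset.card_eq_sum_card_fiberwise (f := Prod.snd) (t := Finset.univ) (by simp)]
    refine Finset.sum_congr rfl fun b _ => ?_
    rw [← Set.ncard_image_of_injective {a | (a, b) ∈ T} (Prod.mk_left_injective b),
      ← Set.ncard_coe_finset]
    congr 1
    ext ⟨a, b'⟩
    simp only [Finset.coe_filter, Set.mem_toFinset, Set.mem_ofPred_eq, Set.mem_image, Prod.mk.injEq]
    grind
  unfold wt
  rw [key, key, Finset.mul_sum]
  refine Finset.sum_le_sum fun b _ => ?_
  by_cases h0 : (fun a => y (a, b)) = 0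
  · have : {a | (a, b) ∈ {p | y p ≠ 0} ∩ {p | z p ≠ 0}} = ∅ :=
      Set.eq_empty_of_forall_notMem fun a ha => ha.1 (congrFun h0 a)
    rw [this, Set.ncard_empty]
    exact Nat.zero_le _
  · have h1 : minDist CA ≤ {a | y (a, b) ≠ 0}.ncard := minDist_le_wt (hy b) h0
    have h2 : {a | (a, b) ∈ {p | y p ≠ 0} ∩ {p | z p ≠ 0}}.ncard ≤ S.ncard :=
      Set.ncard_le_ncard (fun a ha => by by_contra haS; exact ha.2 (hz a b haS)) (Set.toFinite _)
    exact (by omega : _ ≤ minDist CA).trans h1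

theorem wt_add_wt_le {ι : Type*} [Finite ι] (y z : ι → ZMod 2) :
    wt y + wt z ≤ wt (y - z) + 2 * ({i | y i ≠ 0} ∩ {i | z i ≠ 0}).ncard := by
  have h1 := Set.ncard_inter_add_ncard_sdiff_eq_ncard {i | y i ≠ 0} {i | z i ≠ 0} (Set.toFinite _)
  have h2 := Set.ncard_inter_add_ncard_sdiff_eq_ncard {i | z i ≠ 0} {i | y i ≠ 0} (Set.toFinite _)
  rw [Set.inter_comm] at h2
  have h3 : ({i | y i ≠ 0} \ {i | z i ≠ 0}).ncard + ({i | z i ≠ 0} \ {i | y i ≠ 0}).ncard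
      ≤ wt (y - z) := by
    rw [← Set.ncard_union_eq disjoint_sdiff_sdiff (Set.toFinite _) (Set.toFinite _)]
    refine Set.ncard_le_ncard ?_ (Set.toFinite _)
    rintro i (⟨hi, hi'⟩ | ⟨hi, hi'⟩) <;> simp_all
  unfold wt at *
  omega

/-- A column codeword and a row codeword agreeing off few rows and few columns share a tensor
codeword. -/
theorem exists_mem_tensorCode {A B : Type*} [Finite A] [Finite B]
    {CA : Submodule (ZMod 2) (A → ZMod 2)} {CB : Submodule (ZMod 2) (B → ZMod 2)}
    {c r : A × B → ZMod 2} (hc : c ∈ colCode B CA) (hr : r ∈ rowCode A CB)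
    {A' : Set A} {B' : Set B} (hA : A'.ncard < minDist CA) (hB : B'.ncard < minDist CB)
    (hcr : ∀ a b, a ∉ A' → b ∉ B' → c (a, b) = r (a, b)) :
    ∃ t ∈ tensorCode CA CB, (∀ a b, b ∉ B' → t (a, b) = c (a, b)) ∧
      ∀ a b, a ∉ A' → t (a, b) = r (a, b) := by
  obtain ⟨E, hE, hE'⟩ := exists_erasure_decoder hB
  have htc := map_rows_mem_colCode E hc
  have htr : ∀ a b, a ∉ A' → E (fun b => c (a, b)) b = r (a, b) := fun a b ha =>
    congrFun (hE' _ _ (hr a) fun b hb => hcr a b ha hb) b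
  refine ⟨_, ⟨htc, fun a => hE fun b => c (a, b)⟩, fun a b hb => ?_, htr⟩
  refine sub_eq_zero.mp (congrFun (eq_zero_of_support_subset hA
    (CA.sub_mem (htc b) (hc b)) fun a ha => ?_) a)
  exact sub_eq_zero.mpr ((htr a b ha).trans (hcr a b ha hb).symm)

/-- Proposition 2: robustness of the tensor code from
`w`-robustness of the dual tensor code. -/
theorem tensor_robustness_from_dual_robustness
    {A B : Type*} [Finite A] [Finite B] (Δ : ℕ)
    (hcA : Nat.card A = Δ) (hcB : Nat.card B = Δ)
    (CA : Submodule (ZMod 2) (A → ZMod 2)) (CB : Submodule (ZMod 2) (B → ZMod 2))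
    (w : ℝ) (hw : w ≤ (minDist CA : ℝ) * (minDist CB : ℝ) / 2)
    (hrob : IsRobust CA CB w)
    (x : A × B → ZMod 2)
    (hx : (distTo x (colCode B CA : Set (A × B → ZMod 2)) : ℝ)
        + (distTo x (rowCode A CB : Set (A × B → ZMod 2)) : ℝ) ≤ w) :
    (distTo x (tensorCode CA CB : Set (A × B → ZMod 2)) : ℝ) ≤
      3/2 * ((distTo x (colCode B CA : Set (A × B → ZMod 2)) : ℝ)
        + (distTo x (rowCode A CB : Set (A × B → ZMod 2)) : ℝ)) := by
  obtain ⟨c, hc, hxc⟩ := exists_wt_sub_eq_distTo x (colCode B CA)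
  obtain ⟨r, hr, hxr⟩ := exists_wt_sub_eq_distTo x (rowCode A CB)
  rw [← hxc, ← hxr] at hx ⊢
  have hcr : wt (c - r) ≤ wt (x - c) + wt (x - r) := wt_le_wt_add_wt fun i hi => by
    by_contra! h
    exact hi (by simpa using congrArg₂ (· - ·) h.2 h.1)
  have hcrw : (wt (c - r) : ℝ) ≤ w := le_trans (by exact_mod_cast hcr) hx
  rcases Nat.eq_zero_or_pos (minDist CA * minDist CB) with h0 | hpos
  · have h0' : (minDist CA : ℝ) * minDist CB = 0 := by exact_mod_cast h0
    have hz : ((wt (x - c) + wt (x - r) : ℕ) : ℝ) ≤ ((0 : ℕ) : ℝ) := by push_cast; linarith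
    have hz' := Nat.cast_le.mp hz
    have h1 := sub_eq_zero.mp (eq_zero_of_wt_eq_zero (show wt (x - c) = 0 by omega))
    have h2 := sub_eq_zero.mp (eq_zero_of_wt_eq_zero (show wt (x - r) = 0 by omega))
    have h3 : x ∈ tensorCode CA CB := ⟨h1 ▸ hc, h2 ▸ hr⟩
    have h4 := distTo_le_wt_sub (x := x) (SetLike.mem_coe.mpr h3)
    have h5 : wt (x - x) = 0 := by simp [wt]
    rw [Nat.le_zero.mp (h4.trans_eq h5), Nat.cast_zero]
    positivity
  obtain ⟨A', B', hA', hB', hsupp⟩ := hrob (c - r)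
    (Submodule.sub_mem _ (Submodule.mem_sup_left hc) (Submodule.mem_sup_right hr)) hcrw
  have hdA : 0 < minDist CA := Nat.pos_of_mul_pos_right hpos
  have hdB : 0 < minDist CB := Nat.pos_of_mul_pos_left hpos
  have hA2 : 2 * A'.ncard ≤ minDist CA := by
    have hd : (0 : ℝ) < minDist CB := by exact_mod_cast hdB
    rw [le_div_iff₀ hd] at hA'
    have : (2 * A'.ncard : ℝ) ≤ minDist CA := le_of_mul_le_mul_right (by linarith) hd
    exact_mod_cast this
  have hB2 : 2 * B'.ncard ≤ minDist CB := by
    have hd : (0 : ℝ) < minDist CA := by exact_mod_cast hdA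
    rw [le_div_iff₀ hd] at hB'
    have : (2 * B'.ncard : ℝ) ≤ minDist CB := le_of_mul_le_mul_right (by linarith) hd
    exact_mod_cast this
  obtain ⟨t, ht, htc, htr⟩ := exists_mem_tensorCode hc hr (by omega) (by omega)
    fun a b ha hb => sub_eq_zero.mp (hsupp a b ha hb)
  have hy0 : ∀ a b, b ∉ B' → (c - t) (a, b) = 0 := fun a b hb =>
    sub_eq_zero.mpr (htc a b hb).symm
  have hz0 : ∀ a b, a ∉ A' → (r - t) (a, b) = 0 := fun a b ha =>
    sub_eq_zero.mpr (htr a b ha).symm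
  have h1 := two_mul_ncard_inter_le_wt hA2 (Submodule.sub_mem _ hc ht.1) hz0
  have h2 := two_mul_ncard_inter_le_wt (y := (r - t) ∘ Prod.swap) (z := (c - t) ∘ Prod.swap) hB2
    (fun a => Submodule.sub_mem _ hr ht.2 a) (fun b a hb => hy0 a b hb)
  have h2' : ({p | ((r - t) ∘ Prod.swap) p ≠ 0} ∩ {p | ((c - t) ∘ Prod.swap) p ≠ 0}).ncard
      = ({p | (c - t) p ≠ 0} ∩ {p | (r - t) p ≠ 0}).ncard := by
    rw [Set.inter_comm]
    exact Set.ncard_preimage_of_injective_subset_range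
      (s := {p | (c - t) p ≠ 0} ∩ {p | (r - t) p ≠ 0}) Prod.swap_injective
      (by simp [Prod.swap_surjective.range_eq])
  rw [h2', show wt ((r - t) ∘ Prod.swap) = wt (r - t) from
    wt_comp_equiv (r - t) (Equiv.prodComm B A)] at h2
  have h3 := wt_add_wt_le (c - t) (r - t)
  rw [sub_sub_sub_cancel_right] at h3
  have h4 : wt (x - t) ≤ wt (x - c) + wt (c - t) := wt_le_wt_add_wt fun i hi => by
    by_contra! h
    exact hi (by simpa using congrArg₂ (· + ·) h.1 h.2)
  have h5 : wt (x - t) ≤ wt (x - r) + wt (r - t) := wt_le_wt_add_wt fun i hi => by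
    by_contra! h
    exact hi (by simpa using congrArg₂ (· + ·) h.1 h.2)
  have h6 : distTo x (tensorCode CA CB : Set (A × B → ZMod 2)) ≤ wt (x - t) :=
    distTo_le_wt_sub ht
  have h7 : 2 * distTo x (tensorCode CA CB : Set (A × B → ZMod 2))
      ≤ 3 * (wt (x - c) + wt (x - r)) := by omega
  have h8 : (2 : ℝ) * distTo x (tensorCode CA CB : Set (A × B → ZMod 2))
      ≤ 3 * (wt (x - c) + wt (x - r)) := by exact_mod_cast h7
  linarith
end

section
/- Let Δ ≥ 2 and n be positive integers, α > 0, and let d be a real number with d > 2αΔ. Let X be a Δ×n matrix over F₂ all of whose columns have Hamming weight at most √Δ/log₂Δ, and suppose at least d/2 of the rows of X are nonzero. Then the rank of X over F₂ is at least α·√Δ·log₂Δ. -/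
/-- A row of `X` is nonzero only if it meets the support of one of the `X.rank` columns spanning
the column space, so light columns force a large rank. -/
theorem ncard_nonzero_rows_le {m n K : Type*} [Finite m] [Fintype n] [Field K]
    (X : Matrix m n K) (w : ℝ)
    (hw : ∀ j, ({i | X i j ≠ 0}.ncard : ℝ) ≤ w) :
    ({i | ∃ j, X i j ≠ 0}.ncard : ℝ) ≤ X.rank * w := by
  obtain ⟨t, ht, hcard, hspan, -⟩ :=
    Submodule.exists_finset_span_eq_linearIndepOn K (Set.range X.col)
  have hsub : {i | ∃ j, X i j ≠ 0} ⊆ ⋃ v ∈ t, {i | v i ≠ 0} := by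
    rintro i ⟨j, hij⟩
    by_contra hi
    simp only [Set.mem_iUnion, Set.mem_ofPred_eq, not_exists, not_not] at hi
    have hle : Submodule.span K (t : Set (m → K)) ≤ LinearMap.ker (LinearMap.proj i) :=
      Submodule.span_le.2 fun v hv => by simpa using hi v hv
    have hj : X.col j ∈ Submodule.span K (t : Set (m → K)) :=
      hspan ▸ Submodule.subset_span ⟨j, rfl⟩
    exact hij (by simpa using hle hj)
  have hbound : ∀ v ∈ t, ({i | v i ≠ 0}.ncard : ℝ) ≤ w := by
    intro v hv
    obtain ⟨j, rfl⟩ := ht hv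
    exact hw j
  calc ({i | ∃ j, X i j ≠ 0}.ncard : ℝ)
      ≤ ((∑ v ∈ t, {i | v i ≠ 0}.ncard : ℕ) : ℝ) := by
        exact_mod_cast (Set.ncard_le_ncard hsub (Set.toFinite _)).trans
          (Finset.set_ncard_biUnion_le t _)
    _ ≤ t.card * w := by
        push_cast
        simpa using Finset.sum_le_card_nsmul t _ w hbound
    _ = X.rank * w := by rw [hcard, X.rank_eq_finrank_span_cols]

/-- Lemma 6: a matrix with light columns but many nonzero rows
has large rank. -/
theorem light_columns_rank_bound
    (Δ n : ℕ) (hΔ : 2 ≤ Δ) (hn : 0 < n) (α : ℝ) (hα : 0 < α)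
    (d : ℝ) (hd : 2 * α * Δ < d)
    (X : Matrix (Fin Δ) (Fin n) (ZMod 2))
    (hcol : ∀ j : Fin n, (wt (fun i => X i j) : ℝ) ≤ Real.sqrt Δ / Real.logb 2 Δ)
    (hrows : d / 2 ≤ (({i : Fin Δ | ∃ j, X i j ≠ 0}).ncard : ℝ)) :
    α * Real.sqrt Δ * Real.logb 2 Δ ≤ (X.rank : ℝ) := by
  have hrank := ncard_nonzero_rows_le X _ hcol
  have hΔ' : (2 : ℝ) ≤ Δ := by exact_mod_cast hΔ
  have hsqrt : 0 < √(Δ : ℝ) := Real.sqrt_pos.2 (by linarith)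
  have hlog : 0 < Real.logb 2 Δ := Real.logb_pos (by norm_num) (by linarith)
  have hle : α * Δ ≤ X.rank * √(Δ : ℝ) / Real.logb 2 Δ := by
    rw [mul_div_assoc]
    linarith
  rw [le_div_iff₀ hlog] at hle
  refine le_of_mul_le_mul_right ?_ hsqrt
  calc α * √(Δ : ℝ) * Real.logb 2 Δ * √(Δ : ℝ)
      = α * (√(Δ : ℝ) * √(Δ : ℝ)) * Real.logb 2 Δ := by ring
    _ ≤ X.rank * √(Δ : ℝ) := by rwa [Real.mul_self_sqrt (by linarith)]
end

section
/- Let H be an r×n matrix over F₂ chosen uniformly at random, and let V be a fixed linearly independent finite set of vectors of F₂ⁿ. Then the probability that H v = 0 for every v ∈ V is exactly 2^{−r·|V|}. -/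
/-- The linear map sending a matrix to its products with the members of a family of vectors. -/
def mulVecFamily {K ι m n : Type*} [Field K] [Fintype n] (v : ι → n → K) :
    Matrix m n K →ₗ[K] ι → m → K :=
  LinearMap.pi fun i => (Matrix.mulVecBilin K K).flip (v i)

theorem mulVecFamily_apply {K ι m n : Type*} [Field K] [Fintype n] (v : ι → n → K)
    (H : Matrix m n K) (i : ι) : mulVecFamily v H i = H.mulVec (v i) :=
  rfl

theorem mulVecFamily_surjective {K ι m n : Type*} [Field K] [Fintype n] [DecidableEq n]
    {v : ι → n → K} (hv : LinearIndependent K v) :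
    Function.Surjective (mulVecFamily (m := m) v) := by
  intro f
  obtain ⟨g, hg⟩ := LinearMap.exists_extend ((Module.Basis.span hv).constr K f)
  refine ⟨LinearMap.toMatrix' g, funext fun i => ?_⟩
  have h := LinearMap.congr_fun hg (Module.Basis.span hv i)
  rw [Module.Basis.constr_basis, LinearMap.comp_apply, Submodule.subtype_apply,
    Module.Basis.span_apply] at h
  rw [mulVecFamily_apply, LinearMap.toMatrix'_mulVec, h]

/-- First isomorphism theorem, counted: `|ker f| * |B| = |A|` for surjective `f : A →+ B`. -/
theorem AddMonoidHom.card_ker_mul_card_of_surjective {A B : Type*} [AddGroup A] [AddGroup B]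
    {f : A →+ B} (hf : Function.Surjective f) :
    Nat.card f.ker * Nat.card B = Nat.card A := by
  rw [← f.ker.card_mul_index, AddSubgroup.index_ker, AddMonoidHom.range_eq_top.mpr hf,
    AddSubgroup.card_top]

/-- Lemma 8: a fixed linearly independent set of vectors lies in
the kernel of a uniformly random parity-check matrix with probability exactly
`2^{-r|V|}`. -/
theorem random_code_contains_independent_set
    (r n : ℕ) (V : Finset (Fin n → ZMod 2))
    (hV : LinearIndependent (ZMod 2)
      ((↑) : ↥(V : Set (Fin n → ZMod 2)) → (Fin n → ZMod 2))) :
    unifProb {H : Matrix (Fin r) (Fin n) (ZMod 2) | ∀ v ∈ V, H.mulVec v = 0} =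
      (1 : ℝ) / 2 ^ (r * V.card) := by
  classical
  set f := (mulVecFamily (m := Fin r)
    ((↑) : ↥(V : Set (Fin n → ZMod 2)) → (Fin n → ZMod 2))).toAddMonoidHom with hf
  have hker : {H : Matrix (Fin r) (Fin n) (ZMod 2) | ∀ v ∈ V, H.mulVec v = 0} = f.ker := by
    ext H
    simp [hf, AddMonoidHom.mem_ker, funext_iff (f := mulVecFamily _ H), mulVecFamily_apply]
  have hcard := AddMonoidHom.card_ker_mul_card_of_surjective (f := f)
    (mulVecFamily_surjective hV)
  have hcod : Nat.card (↥(V : Set (Fin n → ZMod 2)) → Fin r → ZMod 2) = 2 ^ (r * V.card) := by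
    simp [pow_mul]
  have hpos : (Nat.card f.ker : ℝ) ≠ 0 := Nat.cast_ne_zero.mpr Nat.card_pos.ne'
  rw [unifProb, hker, ← Nat.card_coe_set_eq, ← Nat.card_eq_fintype_card, ← hcard, hcod]
  push_cast
  exact (div_mul_cancel_left₀ hpos _).trans (one_div _).symm
end

section
/- Let H be an r×n matrix over F₂ chosen uniformly at random, and let 0 ≤ p ≤ n. For c ∈ F₂ⁿ let c' ∈ F₂^{n−p} denote the restriction of c to its last n−p coordinates, and let C_p = { c' : c ∈ ker H } be the punctured code. Let V be a fixed linearly independent finite set of vectors of F₂^{n−p}. Then the probability that V ⊆ C_p is at most 2^{−(r−p)·|V|}. -/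
/-- A linearly independent family can be sent to any prescribed family of vectors by a matrix. -/
theorem LinearIndependent.exists_matrix_mulVec_eq {F m n ι : Type*} [Field F] [Fintype n]
    {c : ι → n → F} (hc : LinearIndependent F c) (t : ι → m → F) :
    ∃ H : Matrix m n F, ∀ i, H.mulVec (c i) = t i := by
  classical
  let b := Module.Basis.extend hc.linearIndepOn_id
  let f := b.constr F fun x => Function.extend c t 0 x
  refine ⟨LinearMap.toMatrix' f, fun i => ?_⟩
  rw [LinearMap.toMatrix'_mulVec]
  have hi : c i ∈ hc.linearIndepOn_id.extend (Set.subset_univ _) :=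
    hc.linearIndepOn_id.subset_extend _ ⟨i, rfl⟩
  have hb : b ⟨c i, hi⟩ = c i := Module.Basis.extend_apply_self _ _
  calc f (c i) = f (b ⟨c i, hi⟩) := by rw [hb]
    _ = t i := by
      rw [Module.Basis.constr_basis, hc.injective.extend_apply]

/-- The number of matrices annihilating every vector of a linearly independent family. -/
theorem LinearIndependent.ncard_setOf_mulVec_eq_zero_mul {F m n ι : Type*} [Field F] [Fintype F]
    [Fintype m] [Fintype n] [Fintype ι] {c : ι → n → F} (hc : LinearIndependent F c) :
    {H : Matrix m n F | ∀ i, H.mulVec (c i) = 0}.ncard *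
        (Fintype.card F ^ Fintype.card m) ^ Fintype.card ι = Nat.card (Matrix m n F) := by
  classical
  let f : Matrix m n F →+ (ι → m → F) :=
    { toFun := fun H i => H.mulVec (c i)
      map_zero' := by ext; simp
      map_add' := fun H K => by ext; simp [Matrix.add_mulVec] }
  have hf : f.range = ⊤ := AddMonoidHom.range_eq_top.2 fun t =>
    (hc.exists_matrix_mulVec_eq t).imp fun H hH => funext hH
  have hker : (f.ker : Set (Matrix m n F)) = {H | ∀ i, H.mulVec (c i) = 0} := by
    ext H
    exact funext_iff
  rw [← AddSubgroup.card_mul_index f.ker, AddSubgroup.index_ker, hf, ← hker]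
  congr 1
  simp

/-- Union bound for the number of matrices whose kernel, punctured at the coordinates indexed by `a`,
contains every vector of a linearly independent family. -/
theorem LinearIndependent.ncard_setOf_exists_mulVec_eq_zero_mul_le {F m n k a ι : Type*}
    [Field F] [Fintype F] [Fintype m] [Fintype n] [Fintype a] [Fintype ι]
    {v : ι → k → F} (hv : LinearIndependent F v) (g : a ⊕ k ≃ n) :
    {H : Matrix m n F | ∀ i, ∃ c : n → F, H.mulVec c = 0 ∧ ∀ j, v i j = c (g (.inr j))}.ncard *
        (Fintype.card F ^ Fintype.card m) ^ Fintype.card ι ≤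
      (Fintype.card F ^ Fintype.card a) ^ Fintype.card ι * Nat.card (Matrix m n F) := by
  classical
  let lift (w : ι → a → F) (i : ι) : n → F := Sum.elim (w i) (v i) ∘ g.symm
  have hlift (w : ι → a → F) : LinearIndependent F (lift w) := by
    refine LinearIndependent.of_comp (LinearMap.funLeft F F (g ∘ Sum.inr)) ?_
    convert hv
    ext i j
    simp [lift, LinearMap.funLeft]
  have hsub : {H : Matrix m n F | ∀ i, ∃ c : n → F, H.mulVec c = 0 ∧
      ∀ j, v i j = c (g (.inr j))} ⊆
      ⋃ w : ι → a → F, {H : Matrix m n F | ∀ i, H.mulVec (lift w i) = 0} := by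
    intro H hH
    choose c hc hcv using hH
    refine Set.mem_iUnion.2 ⟨fun i x => c i (g (.inl x)), fun i => ?_⟩
    convert hc i
    ext y
    obtain ⟨x | j, rfl⟩ := g.surjective y <;> simp [lift, hcv]
  calc _ ≤ (∑ w : ι → a → F, {H : Matrix m n F | ∀ i, H.mulVec (lift w i) = 0}.ncard) *
        (Fintype.card F ^ Fintype.card m) ^ Fintype.card ι := by
        gcongr
        exact (Set.ncard_le_ncard hsub (Set.toFinite _)).trans (Set.ncard_iUnion_le_of_fintype _)
    _ = _ := by
        simp_rw [Finset.sum_mul, (hlift _).ncard_setOf_mulVec_eq_zero_mul]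
        simp

/-- Lemma 9: a fixed linearly independent set of vectors lies in
the punctured random code with probability at most `2^{-(r-p)|V|}`. -/
theorem random_punctured_code_contains_independent_set
    (r n p : ℕ) (hp : p ≤ n) (V : Finset (Fin (n - p) → ZMod 2))
    (hV : LinearIndependent (ZMod 2)
      ((↑) : ↥(V : Set (Fin (n - p) → ZMod 2)) → (Fin (n - p) → ZMod 2))) :
    unifProb {H : Matrix (Fin r) (Fin n) (ZMod 2) |
        ∀ v ∈ V, ∃ c : Fin n → ZMod 2, H.mulVec c = 0 ∧
          ∀ j : Fin (n - p), v j = c ⟨p + j.val, by have := j.isLt; omega⟩} ≤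
      (2 : ℝ) ^ (-(((r : ℤ) - (p : ℤ)) * (V.card : ℤ))) := by
  let g : Fin p ⊕ Fin (n - p) ≃ Fin n :=
    finSumFinEquiv.trans (finCongr (Nat.add_sub_cancel' hp))
  have key := LinearIndependent.ncard_setOf_exists_mulVec_eq_zero_mul_le (m := Fin r) hV g
  have hg (j : Fin (n - p)) : g (.inr j) = ⟨p + j.val, by have := j.isLt; omega⟩ := by
    ext
    simp [g]
  simp only [hg, Subtype.forall, Finset.mem_coe, ZMod.card, Fintype.card_fin,
    Fintype.card_coe, Finset.coe_sort_coe, Nat.card_eq_fintype_card] at key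
  have hexp : (2 : ℝ) ^ (-(((r : ℤ) - (p : ℤ)) * (V.card : ℤ))) =
      ((2 : ℝ) ^ p) ^ V.card / ((2 : ℝ) ^ r) ^ V.card := by
    rw [← pow_mul, ← pow_mul, ← zpow_natCast, ← zpow_natCast, ← zpow_sub₀ two_ne_zero]
    congr 1
    push_cast
    ring
  rw [hexp, unifProb, div_le_div_iff₀ (by exact_mod_cast Fintype.card_pos) (by positivity)]
  exact_mod_cast key
end
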